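/- arXiv:2012.00262 — 2 statements merged into one kernel-verified Lean document; each statement's English description precedes it below -/
import Mathlib

section
/- Suppose f : [0,1]² → [0,1] is integrable and satisfies f(x,y) + f(y,x) ≤ 1 for all x, y ∈ [0,1]. Then for every positive integer k, the integral over [0,1]^{k+1} of f(x₀,x₁)·f(x₁,x₂)···f(x_{k-1},x_k) dx₀···dx_k is at most 2^{-k}. -/
open MeasureTheory

/-- A measurable complex function that is bounded everywhere. -/
def IsBddMeasurable {α : Type*} [MeasurableSpace α] (w : α → ℂ) : Prop :=
  Measurable w ∧ ∃ C : ℝ, ∀ x, ‖w x‖ ≤ C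

namespace IsBddMeasurable

variable {α β : Type*} [MeasurableSpace α] [MeasurableSpace β]

theorem integrable {w : α → ℂ} (hw : IsBddMeasurable w) (μ : Measure α) [IsFiniteMeasure μ] :
    Integrable w μ := by
  obtain ⟨hm, C, hC⟩ := hw
  exact Integrable.of_bound hm.aestronglyMeasurable C (.of_forall hC)

theorem comp {w : α → ℂ} (hw : IsBddMeasurable w) {g : β → α} (hg : Measurable g) :
    IsBddMeasurable (fun x => w (g x)) := by
  obtain ⟨hm, C, hC⟩ := hw
  exact ⟨hm.comp hg, C, fun x => hC _⟩

theorem const (c : ℂ) : IsBddMeasurable (fun _ : α => c) :=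
  ⟨measurable_const, ‖c‖, fun _ => le_rfl⟩

theorem mul {u w : α → ℂ} (hu : IsBddMeasurable u) (hw : IsBddMeasurable w) :
    IsBddMeasurable (fun x => u x * w x) := by
  obtain ⟨hum, C, hC⟩ := hu
  obtain ⟨hwm, D, hD⟩ := hw
  refine ⟨hum.mul hwm, C * D, fun x => ?_⟩
  rw [norm_mul]
  exact mul_le_mul (hC x) (hD x) (norm_nonneg _) ((norm_nonneg _).trans (hC x))

theorem add {u w : α → ℂ} (hu : IsBddMeasurable u) (hw : IsBddMeasurable w) :
    IsBddMeasurable (fun x => u x + w x) := by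
  obtain ⟨hum, C, hC⟩ := hu
  obtain ⟨hwm, D, hD⟩ := hw
  exact ⟨hum.add hwm, C + D, fun x => (norm_add_le _ _).trans (add_le_add (hC x) (hD x))⟩

theorem conj {w : α → ℂ} (hw : IsBddMeasurable w) :
    IsBddMeasurable (fun x => (starRingEnd ℂ) (w x)) := by
  obtain ⟨hm, C, hC⟩ := hw
  exact ⟨Complex.continuous_conj.measurable.comp hm, C, fun x => by simpa using hC x⟩

theorem sum {ι : Type*} (s : Finset ι) {w : ι → α → ℂ} (hw : ∀ i ∈ s, IsBddMeasurable (w i)) :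
    IsBddMeasurable (fun x => ∑ i ∈ s, w i x) := by
  classical
  induction s using Finset.induction_on with
  | empty => simpa using const (α := α) 0
  | insert i s hi ih =>
    simp only [Finset.sum_insert hi]
    exact (hw i (by simp)).add (ih fun j hj => hw j (by simp [hj]))

theorem prod {ι : Type*} (s : Finset ι) {w : ι → α → ℂ} (hw : ∀ i ∈ s, IsBddMeasurable (w i)) :
    IsBddMeasurable (fun x => ∏ i ∈ s, w i x) := by
  classical
  induction s using Finset.induction_on with
  | empty => simpa using const (α := α) 1
  | insert i s hi ih =>
    simp only [Finset.prod_insert hi]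
    exact (hw i (by simp)).mul (ih fun j hj => hw j (by simp [hj]))

theorem ofReal {K : α → ℝ} (hK : Measurable K) {C : ℝ} (h : ∀ p, K p ∈ Set.Icc 0 C) :
    IsBddMeasurable (fun p => (K p : ℂ)) :=
  ⟨Complex.measurable_ofReal.comp hK, C, fun p => by
    simpa [abs_of_nonneg (h p).1] using (h p).2⟩

end IsBddMeasurable

section Kernel

variable {α : Type*} [MeasurableSpace α]

/-- The operator `w ↦ (b ↦ ∫ K (a, b) w(a) dμ(a))`. -/
noncomputable def kernelOp (μ : Measure α) (K : α × α → ℝ) (w : α → ℂ) (b : α) : ℂ :=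
  ∫ a, (K (a, b) : ℂ) * w a ∂μ

variable {μ : Measure α} [IsProbabilityMeasure μ] {K : α × α → ℝ} {C : ℝ}

theorem IsBddMeasurable.kernelOp (hK : Measurable K) (hC : ∀ p, K p ∈ Set.Icc 0 C)
    {w : α → ℂ} (hw : IsBddMeasurable w) : IsBddMeasurable (kernelOp μ K w) := by
  obtain ⟨hm, D, hD⟩ := (IsBddMeasurable.ofReal hK hC).mul (hw.comp measurable_fst)
  refine ⟨(hm.stronglyMeasurable.integral_prod_left' (μ := μ)).measurable, D, fun b => ?_⟩
  have := norm_integral_le_of_norm_le_const (μ := μ) (.of_forall fun a => hD (a, b))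
  simpa [_root_.kernelOp] using this

theorem IsBddMeasurable.kernelOp_iterate (hK : Measurable K) (hC : ∀ p, K p ∈ Set.Icc 0 C)
    {w : α → ℂ} (hw : IsBddMeasurable w) (k : ℕ) :
    IsBddMeasurable ((_root_.kernelOp μ K)^[k] w) := by
  induction k with
  | zero => exact hw
  | succ k ih =>
    rw [Function.iterate_succ_apply']
    exact ih.kernelOp hK hC

/-- The weighted path integral is computed by iterating the kernel operator. -/
theorem integral_path_eq_integral_iterate (hK : Measurable K) (hC : ∀ p, K p ∈ Set.Icc 0 C)
    (k : ℕ) {w : α → ℂ} (hw : IsBddMeasurable w) :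
    ∫ x : Fin (k + 1) → α, w (x 0) * ∏ i : Fin k, (K (x i.castSucc, x i.succ) : ℂ)
        ∂Measure.pi (fun _ => μ)
      = ∫ b, (kernelOp μ K)^[k] w b ∂μ := by
  induction k generalizing w with
  | zero =>
    simpa using integral_comp_eval (μ := fun _ : Fin 1 => μ) (i := 0) hw.1.aestronglyMeasurable
  | succ k ih =>
    rw [Function.iterate_succ_apply, ← ih (hw.kernelOp hK hC)]
    have hmp := (measurePreserving_piFinSuccAbove (fun _ : Fin (k + 2) => μ) 0).symm
    rw [← hmp.integral_comp']
    have hKb := IsBddMeasurable.ofReal hK hC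
    rw [integral_prod_symm]
    · refine integral_congr_ae (.of_forall fun y => ?_)
      simp only [kernelOp, ← integral_mul_const]
      refine integral_congr_ae (.of_forall fun a => ?_)
      simp [MeasurableEquiv.piFinSuccAbove_symm_apply, Fin.insertNthEquiv, Fin.prod_univ_succ]
      ring
    · refine IsBddMeasurable.integrable (IsBddMeasurable.comp (w := fun x : Fin (k + 2) → α =>
        w (x 0) * ∏ i : Fin (k + 1), (K (x i.castSucc, x i.succ) : ℂ)) ?_
        (MeasurableEquiv.measurable _)) _
      exact (hw.comp (measurable_pi_apply 0)).mul (.prod _ fun i _ => hKb.comp (by fun_prop))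

theorem sq_integral_norm_le {w : α → ℂ} (hw : IsBddMeasurable w) :
    (∫ a, ‖w a‖ ∂μ) ^ 2 ≤ ∫ a, ‖w a‖ ^ 2 ∂μ := by
  have h1 : Integrable (fun a => ‖w a‖) μ := (hw.integrable μ).norm
  have h2 : Integrable (fun a => ‖w a‖ ^ 2) μ := by
    simpa [pow_two] using ((hw.mul hw).integrable μ).norm
  set c := ∫ a, ‖w a‖ ∂μ with hc
  have h : 0 ≤ ∫ a, (‖w a‖ ^ 2 - 2 * c * ‖w a‖ + c ^ 2) ∂μ :=
    integral_nonneg fun a => by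
      have := sq_nonneg (‖w a‖ - c)
      simp only [Pi.zero_apply]
      linarith
  have h3 : Integrable (fun a => ‖w a‖ ^ 2 - 2 * c * ‖w a‖) μ := h2.sub (h1.const_mul _)
  rw [integral_add h3 (integrable_const _), integral_sub h2 (h1.const_mul _), integral_const_mul, ← hc] at h
  simp at h
  linarith

/-- If `K (a, b) + K (b, a) ≤ 2`, then the kernel operator has numerical radius at most one. -/
theorem norm_integral_kernelOp_mul_conj_le (hK : Measurable K) (hC : ∀ p, K p ∈ Set.Icc 0 C)
    (hsymm : ∀ᵐ p ∂μ.prod μ, K p + K p.swap ≤ 2) {w : α → ℂ} (hw : IsBddMeasurable w) :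
    ‖∫ b, kernelOp μ K w b * (starRingEnd ℂ) (w b) ∂μ‖ ≤ ∫ b, ‖w b‖ ^ 2 ∂μ := by
  have hKb := IsBddMeasurable.ofReal hK hC
  have hint := ((hKb.mul (hw.comp measurable_fst)).mul
    (hw.comp measurable_snd).conj).integrable (μ.prod μ)
  have hnorm : ∀ p : α × α, ‖(K p : ℂ) * w p.1 * (starRingEnd ℂ) (w p.2)‖
      = K p * (‖w p.1‖ * ‖w p.2‖) := fun p => by
    simp [abs_of_nonneg (hC p).1, mul_assoc]
  have hI : Integrable (fun p : α × α => K p * (‖w p.1‖ * ‖w p.2‖)) (μ.prod μ) := by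
    simpa only [hnorm] using hint.norm
  have hI' : Integrable (fun p : α × α => K p.swap * (‖w p.1‖ * ‖w p.2‖)) (μ.prod μ) := by
    refine hI.swap.congr (.of_forall fun p => ?_)
    simp [mul_comm]
  have hJ : Integrable (fun p : α × α => ‖w p.1‖ * ‖w p.2‖) (μ.prod μ) :=
    (hw.integrable μ).norm.mul_prod (hw.integrable μ).norm
  have hswap : ∫ p : α × α, K p.swap * (‖w p.1‖ * ‖w p.2‖) ∂μ.prod μ
      = ∫ p : α × α, K p * (‖w p.1‖ * ‖w p.2‖) ∂μ.prod μ := by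
    rw [← integral_prod_swap]
    simp [mul_comm]
  have hle : ∫ p : α × α, (K p * (‖w p.1‖ * ‖w p.2‖) + K p.swap * (‖w p.1‖ * ‖w p.2‖)) ∂μ.prod μ
      ≤ ∫ p : α × α, 2 * (‖w p.1‖ * ‖w p.2‖) ∂μ.prod μ := by
    refine integral_mono_ae (hI.add hI') (hJ.const_mul 2) ?_
    filter_upwards [hsymm] with p hp
    rw [← add_mul]
    exact mul_le_mul_of_nonneg_right hp (by positivity)
  rw [integral_add hI hI', hswap, integral_const_mul,
    integral_prod_mul (fun a => ‖w a‖) (fun a => ‖w a‖)] at hle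
  have hsq := sq_integral_norm_le (μ := μ) hw
  calc ‖∫ b, kernelOp μ K w b * (starRingEnd ℂ) (w b) ∂μ‖
      = ‖∫ p : α × α, (K p : ℂ) * w p.1 * (starRingEnd ℂ) (w p.2) ∂μ.prod μ‖ := by
        rw [integral_prod_symm _ hint]
        simp only [kernelOp, ← integral_mul_const]
    _ ≤ ∫ p : α × α, K p * (‖w p.1‖ * ‖w p.2‖) ∂μ.prod μ := by
        simpa only [hnorm] using norm_integral_le_integral_norm (μ := μ.prod μ)
          fun p : α × α => (K p : ℂ) * w p.1 * (starRingEnd ℂ) (w p.2)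
    _ ≤ ∫ b, ‖w b‖ ^ 2 ∂μ := by linarith

theorem kernelOp_sum (hK : Measurable K) (hC : ∀ p, K p ∈ Set.Icc 0 C) {ι : Type*} (s : Finset ι)
    (c : ι → ℂ) {w : ι → α → ℂ} (hw : ∀ i, IsBddMeasurable (w i)) (b : α) :
    kernelOp μ K (fun a => ∑ i ∈ s, c i * w i a) b = ∑ i ∈ s, c i * kernelOp μ K (w i) b := by
  simp only [kernelOp, Finset.mul_sum]
  rw [integral_finsetSum]
  · refine Finset.sum_congr rfl fun i _ => ?_
    rw [← integral_const_mul]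
    congr 1 with a
    ring
  · intro i _
    exact (((IsBddMeasurable.ofReal hK hC).comp measurable_prodMk_right).mul
      ((IsBddMeasurable.const (c i)).mul (hw i))).integrable μ

theorem sum_pow_mul_sum_pow {n : ℕ} {ζ : ℂ} (hζ : IsPrimitiveRoot ζ n) (hn : 0 < n) (g : ℕ → ℂ) :
    ∑ j ∈ Finset.range n, ∑ p ∈ Finset.range n, (ζ ^ j) ^ p * g p = n * g 0 := by
  rw [Finset.sum_comm, Finset.sum_eq_single 0]
  · simp
  · intro p hp hp0
    have hne : ζ ^ p ≠ 1 := hζ.pow_ne_one_of_pos_of_lt hp0 (Finset.mem_range.1 hp)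
    rw [← Finset.sum_mul]
    simp_rw [pow_right_comm ζ _ p]
    rw [geom_sum_eq hne, pow_right_comm, hζ.pow_eq_one]
    simp
  · simp [hn.ne']

/-- The power inequality for the numerical radius (Berger), in the case of kernel operators: if
`K (a, b) + K (b, a) ≤ 2` then `re ⟪K ^ n 1, 1⟫ ≤ 1`. -/
theorem re_integral_kernelOp_iterate_le (hK : Measurable K) (hC : ∀ p, K p ∈ Set.Icc 0 C)
    (hsymm : ∀ᵐ p ∂μ.prod μ, K p + K p.swap ≤ 2) {n : ℕ} (hn : 0 < n) :
    (∫ b, (kernelOp μ K)^[n] (fun _ => 1) b ∂μ).re ≤ 1 := by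
  set g : ℕ → α → ℂ := fun m => (kernelOp μ K)^[m] (fun _ => 1) with hg
  have hgb : ∀ m, IsBddMeasurable (g m) := fun m =>
    (IsBddMeasurable.const 1).kernelOp_iterate hK hC m
  have hgs : ∀ m, kernelOp μ K (g m) = g (m + 1) := fun m => by
    simp only [hg, Function.iterate_succ_apply']
  obtain ⟨ζ, hζ⟩ : ∃ ζ : ℂ, IsPrimitiveRoot ζ n := ⟨_, Complex.isPrimitiveRoot_exp n hn.ne'⟩
  set y : ℕ → α → ℂ := fun j b => ∑ p ∈ Finset.range n, (ζ ^ j) ^ p * g p b with hy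
  have hyb : ∀ j, IsBddMeasurable (y j) := fun j =>
    .sum _ fun p _ => (IsBddMeasurable.const _).mul (hgb p)
  have hd : IsBddMeasurable (fun b => 1 + (-1) * g n b) :=
    (IsBddMeasurable.const 1).add ((IsBddMeasurable.const (-1)).mul (hgb n))
  have htel : ∀ j b, y j b - ζ ^ j * kernelOp μ K (y j) b = 1 + (-1) * g n b := by
    intro j b
    have h1 : kernelOp μ K (y j) b = ∑ p ∈ Finset.range n, (ζ ^ j) ^ p * g (p + 1) b := by
      simp only [hy, kernelOp_sum hK hC _ _ hgb, hgs]
    have h2 := Finset.sum_range_sub' (fun p => (ζ ^ j) ^ p * g p b) n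
    rw [pow_right_comm ζ j n, hζ.pow_eq_one, one_pow] at h2
    rw [h1, hy, Finset.mul_sum, ← Finset.sum_sub_distrib]
    simp only [pow_zero, one_mul] at h2
    have h0 : g 0 b = 1 := rfl
    rw [h0] at h2
    rw [neg_one_mul, ← sub_eq_add_neg, ← h2]
    refine Finset.sum_congr rfl fun p _ => ?_
    ring
  have hpos : ∀ j, 0 ≤ (∫ b, (1 + (-1) * g n b) * (starRingEnd ℂ) (y j b) ∂μ).re := by
    intro j
    have hyy := ((hyb j).mul (hyb j).conj).integrable μ
    have hTy := (((hyb j).kernelOp (μ := μ) hK hC).mul (hyb j).conj).integrable μ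
    have hnr := norm_integral_kernelOp_mul_conj_le hK hC hsymm (hyb j)
    have hsplit : ∫ b, (1 + (-1) * g n b) * (starRingEnd ℂ) (y j b) ∂μ
        = ((∫ b, ‖y j b‖ ^ 2 ∂μ : ℝ) : ℂ)
          - ζ ^ j * ∫ b, kernelOp μ K (y j) b * (starRingEnd ℂ) (y j b) ∂μ := by
      rw [← integral_complex_ofReal, ← integral_const_mul]
      simp only [Complex.ofReal_pow, ← Complex.mul_conj']
      rw [← integral_sub hyy (hTy.const_mul _)]
      congr 1 with b
      rw [← htel j b]
      ring
    have hle := (Complex.re_le_norm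
      (ζ ^ j * ∫ b, kernelOp μ K (y j) b * (starRingEnd ℂ) (y j b) ∂μ)).trans_eq (norm_mul _ _)
    rw [norm_pow, hζ.norm'_eq_one hn.ne', one_pow, one_mul] at hle
    rw [hsplit, Complex.sub_re, Complex.ofReal_re]
    linarith
  have hsum : ∑ j ∈ Finset.range n, ∫ b, (1 + (-1) * g n b) * (starRingEnd ℂ) (y j b) ∂μ
      = n * (1 - ∫ b, g n b ∂μ) := by
    rw [← integral_finsetSum _ fun j _ => (hd.mul (hyb j).conj).integrable μ]
    have : ∀ b, ∑ j ∈ Finset.range n, (1 + (-1) * g n b) * (starRingEnd ℂ) (y j b)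
        = n * (1 - g n b) := by
      intro b
      rw [← Finset.mul_sum, ← map_sum, hy, sum_pow_mul_sum_pow hζ hn (fun p => g p b)]
      simp [hg]
      ring
    simp only [this]
    rw [integral_const_mul, integral_sub (integrable_const _) ((hgb n).integrable μ)]
    simp
  have hnonneg := Finset.sum_nonneg fun j (_ : j ∈ Finset.range n) => hpos j
  rw [← Complex.re_sum, hsum, ← Complex.ofReal_natCast, Complex.re_ofReal_mul, Complex.sub_re,
    Complex.one_re] at hnonneg
  have := nonneg_of_mul_nonneg_right hnonneg (by exact_mod_cast hn)
  linarith

/-- A kernel with `K (a, b) + K (b, a) ≤ 1` has `n`-edge path density at most `2⁻ⁿ`. -/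
theorem integral_path_le (hK : Measurable K) (hC : ∀ p, K p ∈ Set.Icc (0 : ℝ) 1)
    (hsymm : ∀ᵐ p ∂μ.prod μ, K p + K p.swap ≤ 1) {n : ℕ} (hn : 0 < n) :
    ∫ x : Fin (n + 1) → α, ∏ i : Fin n, K (x i.castSucc, x i.succ) ∂Measure.pi (fun _ => μ)
      ≤ (1 / 2 : ℝ) ^ n := by
  have hK2 : Measurable fun p => 2 * K p := hK.const_mul 2
  have hC2 : ∀ p, 2 * K p ∈ Set.Icc (0 : ℝ) 2 := fun p =>
    ⟨by linarith [(hC p).1], by linarith [(hC p).2]⟩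
  have hs2 : ∀ᵐ p ∂μ.prod μ, 2 * K p + 2 * K p.swap ≤ 2 := by
    filter_upwards [hsymm] with p hp
    linarith
  have h := re_integral_kernelOp_iterate_le hK2 hC2 hs2 hn
  rw [← integral_path_eq_integral_iterate hK2 hC2 n (.const 1)] at h
  simp only [one_mul, ← Complex.ofReal_prod, integral_complex_ofReal, Complex.ofReal_re,
    Finset.prod_mul_distrib, Finset.prod_const, Finset.card_univ, Fintype.card_fin,
    integral_const_mul] at h
  rw [one_div, inv_pow, ← one_div, le_div_iff₀' (by positivity)]
  exact h

end Kernel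

theorem measurePreserving_eval_pair {ι α : Type*} [Fintype ι] [MeasurableSpace α] (μ : Measure α)
    [IsProbabilityMeasure μ] {i j : ι} (hij : i ≠ j) :
    MeasurePreserving (fun x : ι → α => (x i, x j)) (Measure.pi fun _ => μ) (μ.prod μ) := by
  refine ⟨by fun_prop, ?_⟩
  have hind := (ProbabilityTheory.iIndepFun_pi (μ := fun _ : ι => μ) (X := fun _ => id)
    fun _ => aemeasurable_id).indepFun hij
  have h := hind.map_prod_eq_prod_map_map (measurable_pi_apply i).aemeasurable
    (measurable_pi_apply j).aemeasurable
  rw [h]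
  exact congrArg₂ _ (measurePreserving_eval (fun _ : ι => μ) i).map_eq
    (measurePreserving_eval (fun _ : ι => μ) j).map_eq

theorem path_density_le (f : ℝ → ℝ → ℝ)
    (hint : IntegrableOn (fun p : ℝ × ℝ => f p.1 p.2)
      (Set.Icc (0:ℝ) 1 ×ˢ Set.Icc (0:ℝ) 1))
    (hrange : ∀ x ∈ Set.Icc (0:ℝ) 1, ∀ y ∈ Set.Icc (0:ℝ) 1, f x y ∈ Set.Icc (0:ℝ) 1)
    (hanti : ∀ x ∈ Set.Icc (0:ℝ) 1, ∀ y ∈ Set.Icc (0:ℝ) 1, f x y + f y x ≤ 1)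
    (k : ℕ) (hk : 0 < k) :
    (∫ x in Set.univ.pi (fun _ : Fin (k+1) => Set.Icc (0:ℝ) 1),
      ∏ i : Fin k, f (x i.castSucc) (x i.succ)) ≤ (1/2 : ℝ) ^ k := by
  set I : Set ℝ := Set.Icc (0 : ℝ) 1 with hI
  set μ : Measure ℝ := volume.restrict I with hμ
  have : IsProbabilityMeasure μ := ⟨by simp [hμ, hI]⟩
  have hprod : (volume : Measure (ℝ × ℝ)).restrict (I ×ˢ I) = μ.prod μ := by
    rw [Measure.volume_eq_prod, Measure.prod_restrict]
  have hmem : ∀ᵐ p ∂μ.prod μ, p ∈ I ×ˢ I := by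
    rw [← hprod]
    exact ae_restrict_mem (measurableSet_Icc.prod measurableSet_Icc)
  have hm : AEMeasurable (fun p : ℝ × ℝ => f p.1 p.2) (μ.prod μ) := by
    rw [← hprod]
    exact hint.aemeasurable
  obtain ⟨K, hK, hKr, hfK⟩ := hm.exists_ae_eq_range_subset (t := Set.Icc (0 : ℝ) 1)
    (hmem.mono fun p hp => hrange _ hp.1 _ hp.2) ⟨0, by simp⟩
  have hC : ∀ p, K p ∈ Set.Icc (0 : ℝ) 1 := fun p => hKr ⟨p, rfl⟩
  have hsymm : ∀ᵐ p ∂μ.prod μ, K p + K p.swap ≤ 1 := by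
    have hswap := (Measure.measurePreserving_swap (μ := μ) (ν := μ)).quasiMeasurePreserving.ae hfK
    filter_upwards [hmem, hfK, hswap] with p hp h1 h2
    rw [← h1, ← h2]
    exact hanti _ hp.1 _ hp.2
  rw [volume_pi, Measure.restrict_pi_pi]
  refine le_trans (le_of_eq (integral_congr_ae ?_)) (integral_path_le (μ := μ) hK hC hsymm hk)
  have hall : ∀ i : Fin k, ∀ᵐ x ∂Measure.pi (fun _ : Fin (k + 1) => μ),
      f (x i.castSucc) (x i.succ) = K (x i.castSucc, x i.succ) := fun i =>
    (measurePreserving_eval_pair μ (Fin.castSucc_lt_succ (i := i)).ne).quasiMeasurePreserving.ae hfK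
  filter_upwards [ae_all_iff.2 hall] with x hx
  exact Finset.prod_congr rfl fun i _ => hx i
end

section
/- An n-vertex tournament in which the sum over all vertices v of |indeg(v) − n/2| is at least ε n² has at most (1 − 2ε²) n (n/2)^k directed k-edge paths, for every k ≥ 2. -/
open scoped Matrix

/-- One application of `x ↦ ⟪e, x⟫ • e + B x`, with `B` skew and small, does not increase the
quadratic form `‖x‖² + 2⟪e, x⟫⟪e, B x⟫`, which dominates the square of the image's component
along `e`. -/
lemma quadForm_rankOne_add_skew_le {E : Type*} [NormedAddCommGroup E] [InnerProductSpace ℝ E]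
    {e : E} (he : ‖e‖ = 1) {B : E →ₗ[ℝ] E} (hskew : ∀ x y, inner ℝ (B x) y = -inner ℝ x (B y))
    (hB : ∀ x, 2 * ‖B x‖ ^ 2 ≤ ‖x‖ ^ 2) (x : E) :
    inner ℝ e (inner ℝ e x • e + B x) ^ 2 ≤
        ‖x‖ ^ 2 + 2 * inner ℝ e x * inner ℝ e (B x) ∧
      ‖inner ℝ e x • e + B x‖ ^ 2 + 2 * inner ℝ e (inner ℝ e x • e + B x) *
          inner ℝ e (B (inner ℝ e x • e + B x)) ≤
        ‖x‖ ^ 2 + 2 * inner ℝ e x * inner ℝ e (B x) := by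
  have hee : inner ℝ e e = 1 := by rw [real_inner_self_eq_norm_sq, he, one_pow]
  have heB : inner ℝ e (B e) = 0 := by
    have h := hskew e e
    rw [real_inner_comm] at h
    linarith
  set c := inner ℝ e x with hc
  set p := inner ℝ e (B x) with hp
  set q := inner ℝ e (B (B x)) with hq
  have hBeBx : inner ℝ (B e) (B x) = -q := hskew e (B x)
  have hxe : inner ℝ x e = c := real_inner_comm _ _
  have hnorm : ∀ s : ℝ, ‖s • e - x‖ ^ 2 = s ^ 2 - 2 * s * c + ‖x‖ ^ 2 := fun s ↦ by
    rw [norm_sub_sq_real, norm_smul, he, inner_smul_left, ← hc]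
    simp only [Real.norm_eq_abs, mul_one, sq_abs, conj_trivial]
    ring
  have hBnorm : ∀ s : ℝ,
      ‖B (s • e - x)‖ ^ 2 = s ^ 2 * ‖B e‖ ^ 2 + 2 * s * q + ‖B x‖ ^ 2 := fun s ↦ by
    rw [map_sub, map_smul, norm_sub_sq_real, norm_smul, inner_smul_left, hBeBx, mul_pow]
    simp only [Real.norm_eq_abs, sq_abs, conj_trivial]
    ring
  have hp_le : 2 * p ^ 2 ≤ ‖x‖ ^ 2 - c ^ 2 := by
    have h1 : inner ℝ e (B (c • e - x)) = -p := by
      rw [map_sub, map_smul, inner_sub_right, inner_smul_right, heB]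
      ring
    have h2 := abs_real_inner_le_norm e (B (c • e - x))
    rw [h1, he, one_mul, abs_neg] at h2
    have h3 := hB (c • e - x)
    rw [hnorm] at h3
    have h4 : p ^ 2 ≤ ‖B (c • e - x)‖ ^ 2 := by
      rw [← sq_abs p]
      gcongr
    linarith
  have heT : inner ℝ e (c • e + B x) = c + p := by
    rw [inner_add_right, inner_smul_right, hee, mul_one]
  have heBT : inner ℝ e (B (c • e + B x)) = q := by
    rw [map_add, map_smul, inner_add_right, inner_smul_right, heB, mul_zero, zero_add]
  have hT : ‖c • e + B x‖ ^ 2 = c ^ 2 + 2 * c * p + ‖B x‖ ^ 2 := by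
    rw [norm_add_sq_real, norm_smul, he, inner_smul_left, ← hp]
    simp only [Real.norm_eq_abs, mul_one, sq_abs, conj_trivial]
    ring
  rw [heT, heBT, hT]
  have h5 := hB ((c + p) • e - x)
  rw [hnorm, hBnorm] at h5
  have h6 : 0 ≤ (c + p) ^ 2 * ‖B e‖ ^ 2 := by positivity
  constructor <;> nlinarith

/-- Iterating a rank-one projection perturbed by a small skew map `B`, starting at the unit vector
`e` it projects onto, brings the component along `e` down to at most `1 - ‖B e‖² / 2`. -/
lemma inner_iterate_rankOne_add_skew_le {E : Type*} [NormedAddCommGroup E] [InnerProductSpace ℝ E]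
    {e : E} (he : ‖e‖ = 1) {B : E →ₗ[ℝ] E} (hskew : ∀ x y, inner ℝ (B x) y = -inner ℝ x (B y))
    (hB : ∀ x, 2 * ‖B x‖ ^ 2 ≤ ‖x‖ ^ 2) {G : ℕ → E} (hG0 : G 0 = e)
    (hG : ∀ k, G (k + 1) = inner ℝ e (G k) • e + B (G k)) (k : ℕ) :
    inner ℝ e (G (k + 2)) ≤ 1 - ‖B e‖ ^ 2 / 2 := by
  have hee : inner ℝ e e = 1 := by rw [real_inner_self_eq_norm_sq, he, one_pow]
  have heB : inner ℝ e (B e) = 0 := by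
    have h := hskew e e
    rw [real_inner_comm] at h
    linarith
  have hm := hB e
  rw [he] at hm
  have key : ∀ j, ‖G (j + 1)‖ ^ 2 + 2 * inner ℝ e (G (j + 1)) * inner ℝ e (B (G (j + 1))) ≤
      1 - ‖B e‖ ^ 2 := by
    intro j
    induction j with
    | zero =>
      have h1 : inner ℝ e (B (B e)) = -‖B e‖ ^ 2 := by
        have h := hskew e (B e)
        rw [real_inner_self_eq_norm_sq] at h
        linarith
      rw [hG, hG0, hee, one_smul, map_add, norm_add_sq_real, inner_add_right, inner_add_right,
        hee, heB, h1, he]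
      linarith
    | succ j ih =>
      rw [hG (j + 1)]
      exact (quadForm_rankOne_add_skew_le he hskew hB _).2.trans ih
  have h := (quadForm_rankOne_add_skew_le he hskew hB (G (k + 1))).1.trans (key k)
  rw [← hG] at h
  refine le_of_sq_le_sq (h.trans ?_) (by linarith)
  nlinarith [sq_nonneg (‖B e‖ ^ 2)]

/-- A skew-symmetric real matrix with entries of absolute value at most `1 / n` has squared
operator norm at most `1 / 2`. -/
lemma two_mul_norm_sq_toEuclideanLin_le {n : ℕ} {B : Matrix (Fin n) (Fin n) ℝ}
    (hskew : ∀ u v, B v u = -B u v) (hB : ∀ u v, |B u v| ≤ 1 / n)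
    (x : EuclideanSpace ℝ (Fin n)) :
    2 * ‖Matrix.toEuclideanLin B x‖ ^ 2 ≤ ‖x‖ ^ 2 := by
  set w := Matrix.toEuclideanLin B x
  have hwu : ∀ u, w u = ∑ v, B u v * x v := fun u ↦ rfl
  rw [EuclideanSpace.real_norm_sq_eq, EuclideanSpace.real_norm_sq_eq]
  have hX : 0 ≤ ∑ u, x u ^ 2 := Finset.sum_nonneg fun _ _ ↦ sq_nonneg _
  have hQ : 0 ≤ ∑ u, w u ^ 2 := Finset.sum_nonneg fun _ _ ↦ sq_nonneg _
  have h1 : ∑ u, ∑ v, B u v * (w u * x v) = ∑ u, w u ^ 2 := by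
    refine Finset.sum_congr rfl fun u _ ↦ ?_
    calc ∑ v, B u v * (w u * x v) = w u * ∑ v, B u v * x v := by
          rw [Finset.mul_sum]
          exact Finset.sum_congr rfl fun v _ ↦ by ring
      _ = w u ^ 2 := by rw [← hwu, sq]
  have h2 : ∑ u, ∑ v, B u v * (x u * w v) = -∑ u, w u ^ 2 := by
    rw [Finset.sum_comm, ← h1, ← Finset.sum_neg_distrib]
    refine Finset.sum_congr rfl fun u _ ↦ ?_
    rw [← Finset.sum_neg_distrib]
    exact Finset.sum_congr rfl fun v _ ↦ by rw [hskew u v]; ring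
  have h3 : ∑ i : Fin n × Fin n, B i.1 i.2 * (w i.1 * x i.2 - x i.1 * w i.2) =
      2 * ∑ u, w u ^ 2 := by
    simp only [Fintype.sum_prod_type, mul_sub, Finset.sum_sub_distrib, h1, h2]
    ring
  have h4 : ∑ i : Fin n × Fin n, (w i.1 * x i.2 - x i.1 * w i.2) ^ 2 ≤
      2 * ((∑ u, w u ^ 2) * ∑ u, x u ^ 2) := by
    have h5 : ∑ i : Fin n × Fin n, (w i.1 * x i.2 - x i.1 * w i.2) ^ 2 =
        (∑ u, w u ^ 2) * (∑ u, x u ^ 2) + (∑ u, x u ^ 2) * (∑ u, w u ^ 2)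
          - 2 * ((∑ u, w u * x u) * (∑ u, w u * x u)) := by
      rw [Finset.sum_mul_sum, Finset.sum_mul_sum, Finset.sum_mul_sum, Fintype.sum_prod_type,
        Finset.mul_sum, ← Finset.sum_add_distrib, ← Finset.sum_sub_distrib]
      simp only [Finset.mul_sum, ← Finset.sum_add_distrib, ← Finset.sum_sub_distrib]
      exact Finset.sum_congr rfl fun u _ ↦ Finset.sum_congr rfl fun v _ ↦ by ring
    rw [h5]
    nlinarith [mul_self_nonneg (∑ u, w u * x u)]
  have h6 : ∑ i : Fin n × Fin n, B i.1 i.2 ^ 2 ≤ 1 := by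
    calc ∑ i : Fin n × Fin n, B i.1 i.2 ^ 2 ≤ ∑ _i : Fin n × Fin n, (1 / n : ℝ) ^ 2 := by
          refine Finset.sum_le_sum fun i _ ↦ ?_
          rw [← sq_abs]
          gcongr
          exact hB _ _
      _ ≤ 1 := by
          simp only [Finset.sum_const, Finset.card_univ, Fintype.card_prod, Fintype.card_fin,
            nsmul_eq_mul, Nat.cast_mul]
          rcases eq_or_ne (n : ℝ) 0 with h | h
          · simp [h]
          · exact le_of_eq (by field_simp)
  have h7 := Finset.sum_mul_sq_le_sq_mul_sq Finset.univ
    (fun i : Fin n × Fin n ↦ B i.1 i.2) (fun i ↦ w i.1 * x i.2 - x i.1 * w i.2)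
  rw [h3] at h7
  have h8 : (2 * ∑ u, w u ^ 2) ^ 2 ≤ 1 * (2 * ((∑ u, w u ^ 2) * ∑ u, x u ^ 2)) :=
    h7.trans (mul_le_mul h6 h4 (Finset.sum_nonneg fun _ _ ↦ sq_nonneg _) zero_le_one)
  rcases hQ.eq_or_lt with h | h
  · rw [← h]
    linarith
  · refine le_of_mul_le_mul_left ?_ h
    nlinarith

/-- The all-ones form of the `k`-th power of a matrix `M` is a weighted count of walks. -/
lemma sum_prod_eq_dotProduct_pow_mulVec {ι R : Type*} [Fintype ι] [DecidableEq ι] [CommSemiring R]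
    (M : Matrix ι ι R) (k : ℕ) (h : ι → R) :
    ∑ v : Fin (k + 1) → ι, h (v 0) * ∏ i : Fin k, M (v i.castSucc) (v i.succ) =
      h ⬝ᵥ (M ^ k) *ᵥ 1 := by
  induction k generalizing h with
  | zero =>
    rw [← (Equiv.funUnique (Fin 1) ι).symm.sum_comp]
    simp [dotProduct]
  | succ k ih =>
    rw [pow_succ', ← Matrix.mulVec_mulVec, Matrix.dotProduct_mulVec, ← ih,
      ← (Fin.consEquiv fun _ ↦ ι).sum_comp, Fintype.sum_prod_type_right]
    refine Finset.sum_congr rfl fun v _ ↦ ?_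
    simp only [Matrix.vecMul, dotProduct, Finset.sum_mul]
    refine Finset.sum_congr rfl fun u _ ↦ ?_
    simp [Fin.prod_univ_succ, Fin.consEquiv, mul_assoc]

/-- Walk bound for a matrix `M` with entries in `[0, 1]` and `M + Mᵀ` the all-ones matrix. -/
lemma one_dotProduct_pow_mulVec_le {n : ℕ} (hn : n ≠ 0) {M : Matrix (Fin n) (Fin n) ℝ}
    (hM0 : ∀ u v, 0 ≤ M u v) (hM : ∀ u v, M u v + M v u = 1) (k : ℕ) :
    1 ⬝ᵥ (M ^ (k + 2)) *ᵥ 1 ≤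
      (1 - (∑ u, (2 * ∑ v, M u v - n) ^ 2) / n ^ 3 / 2) * n * (n / 2 : ℝ) ^ (k + 2) := by
  have hn0 : (n : ℝ) ≠ 0 := by exact_mod_cast hn
  have hnpos : (0 : ℝ) < n := by positivity
  have hsq : (√n : ℝ) ^ 2 = n := Real.sq_sqrt hnpos.le
  have hs : (√n : ℝ) ≠ 0 := by positivity
  let B : Matrix (Fin n) (Fin n) ℝ := Matrix.of fun u v ↦ (2 * M u v - 1) / n
  have hBskew : ∀ u v, B v u = -B u v := fun u v ↦ by
    simp only [B, Matrix.of_apply]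
    rw [← neg_div]
    congr 1
    linarith [hM u v]
  have hBabs : ∀ u v, |B u v| ≤ 1 / n := fun u v ↦ by
    simp only [B, Matrix.of_apply, abs_div, Nat.abs_cast]
    gcongr
    rw [abs_le]
    constructor <;> linarith [hM u v, hM0 u v, hM0 v u]
  let G : ℕ → EuclideanSpace ℝ (Fin n) := fun j ↦
    WithLp.toLp 2 fun u ↦ (2 / n : ℝ) ^ j / √n * ((M ^ j) *ᵥ 1) u
  have hinner : ∀ j, inner ℝ (G 0) (G j) = (2 / n : ℝ) ^ j / n * (1 ⬝ᵥ (M ^ j) *ᵥ 1) := by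
    intro j
    simp only [G, PiLp.inner_apply, RCLike.inner_apply, dotProduct, Finset.mul_sum]
    refine Finset.sum_congr rfl fun u _ ↦ ?_
    simp
    field_simp
    rw [hsq]
  have he : ‖G 0‖ = 1 := by
    have h : ‖G 0‖ ^ 2 = 1 := by
      rw [← real_inner_self_eq_norm_sq, hinner]
      simp [dotProduct, hn0]
    exact (pow_eq_one_iff_of_nonneg (norm_nonneg _) two_ne_zero).1 h
  have hG : ∀ j, G (j + 1) = inner ℝ (G 0) (G j) • G 0 + Matrix.toEuclideanLin B (G j) := by
    intro j
    ext u
    rw [hinner]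
    change (2 / n : ℝ) ^ (j + 1) / √n * ((M ^ (j + 1)) *ᵥ 1) u =
      (2 / n : ℝ) ^ j / n * (1 ⬝ᵥ (M ^ j) *ᵥ 1) * ((2 / n : ℝ) ^ 0 / √n * ((M ^ 0) *ᵥ 1) u) +
        ∑ v, B u v * ((2 / n : ℝ) ^ j / √n * ((M ^ j) *ᵥ 1) v)
    rw [pow_succ' M, ← Matrix.mulVec_mulVec, pow_zero, pow_zero, Matrix.one_mulVec]
    generalize (M ^ j) *ᵥ 1 = y
    simp only [Matrix.mulVec, dotProduct, Pi.one_apply, one_mul, mul_one,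
      Finset.mul_sum, Finset.sum_mul, ← Finset.sum_add_distrib, B, Matrix.of_apply]
    refine Finset.sum_congr rfl fun v _ ↦ ?_
    rw [pow_succ]
    field_simp
    ring
  have hskew : ∀ x y, inner ℝ (Matrix.toEuclideanLin B x) y =
      -inner ℝ x (Matrix.toEuclideanLin B y) := by
    intro x y
    change ∑ u, y u * (∑ v, B u v * x v) = -∑ u, (∑ v, B u v * y v) * x u
    simp only [Finset.mul_sum, Finset.sum_mul, ← Finset.sum_neg_distrib]
    rw [Finset.sum_comm]
    exact Finset.sum_congr rfl fun u _ ↦ Finset.sum_congr rfl fun v _ ↦ by rw [hBskew u v]; ring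
  have hBe : ‖Matrix.toEuclideanLin B (G 0)‖ ^ 2 =
      (∑ u, (2 * ∑ v, M u v - n) ^ 2) / n ^ 3 := by
    rw [EuclideanSpace.real_norm_sq_eq, Finset.sum_div]
    refine Finset.sum_congr rfl fun u _ ↦ ?_
    have h : (Matrix.toEuclideanLin B (G 0)) u = (2 * ∑ v, M u v - n) / n / √n := by
      change ∑ v, (2 * M u v - 1) / n * ((2 / n : ℝ) ^ 0 / √n * ((M ^ 0) *ᵥ 1) v) = _
      simp only [pow_zero, Matrix.one_mulVec, Pi.one_apply, mul_one, ← Finset.sum_mul,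
        ← Finset.sum_div, Finset.sum_sub_distrib, ← Finset.mul_sum]
      simp
      ring
    rw [h, div_pow, div_pow, hsq]
    field_simp
  have h := inner_iterate_rankOne_add_skew_le he hskew
    (two_mul_norm_sq_toEuclideanLin_le hBskew hBabs) rfl hG k
  rw [hinner, hBe] at h
  have h2 : (2 / n : ℝ) ^ (k + 2) * (n / 2) ^ (k + 2) = 1 := by
    rw [← mul_pow]
    field_simp
    simp
  calc (1 : Fin n → ℝ) ⬝ᵥ (M ^ (k + 2)) *ᵥ 1 =
        ((2 / n : ℝ) ^ (k + 2) * (n / 2) ^ (k + 2)) * (1 ⬝ᵥ (M ^ (k + 2)) *ᵥ 1) := by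
        rw [h2, one_mul]
    _ = (2 / n : ℝ) ^ (k + 2) / n * (1 ⬝ᵥ (M ^ (k + 2)) *ᵥ 1) * n * (n / 2) ^ (k + 2) := by
        generalize (2 / n : ℝ) ^ (k + 2) = a
        generalize (n / 2 : ℝ) ^ (k + 2) = b
        field_simp
    _ ≤ _ := by gcongr

/-- Putting weight `1 / 2` on the diagonal of a matrix with entries in `[0, 1]` increases its walk
count by a factor of at least `1 + 1 / (2n)`. -/
lemma walk_count_le_add_half {n : ℕ} (hn : n ≠ 0) {W : Matrix (Fin n) (Fin n) ℝ}
    (hW0 : ∀ u v, 0 ≤ W u v) (hW1 : ∀ u v, W u v ≤ 1) (k : ℕ) :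
    (1 + 1 / (2 * n)) * (1 ⬝ᵥ (W ^ (k + 1)) *ᵥ 1) ≤
      1 ⬝ᵥ ((W + (1 / 2 : ℝ) • (1 : Matrix (Fin n) (Fin n) ℝ)) ^ (k + 1)) *ᵥ 1 := by
  have hn0 : (0 : ℝ) < n := by positivity
  set M := W + (1 / 2 : ℝ) • (1 : Matrix (Fin n) (Fin n) ℝ) with hM
  have hmul : ∀ x, M *ᵥ x = W *ᵥ x + (1 / 2 : ℝ) • x := fun x ↦ by
    rw [hM, Matrix.add_mulVec, Matrix.smul_mulVec, Matrix.one_mulVec]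
  have hmono : ∀ x y : Fin n → ℝ, x ≤ y → W *ᵥ x ≤ W *ᵥ y := fun x y h u ↦
    dotProduct_le_dotProduct_of_nonneg_left h (hW0 u)
  have hnn : ∀ j, (0 : Fin n → ℝ) ≤ (W ^ j) *ᵥ 1 := by
    intro j
    induction j with
    | zero => simp
    | succ j ih =>
      rw [pow_succ', ← Matrix.mulVec_mulVec]
      simpa using hmono _ _ ih
  have hstep : ∀ j, (W ^ j) *ᵥ 1 ≤ (M ^ j) *ᵥ 1 →
      (W ^ (j + 1)) *ᵥ 1 + (1 / 2 : ℝ) • (W ^ j) *ᵥ 1 ≤ (M ^ (j + 1)) *ᵥ 1 := by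
    intro j h
    rw [pow_succ', pow_succ', ← Matrix.mulVec_mulVec, ← Matrix.mulVec_mulVec, hmul]
    exact add_le_add (hmono _ _ h) (smul_le_smul_of_nonneg_left h (by norm_num))
  have hle : ∀ j, (W ^ j) *ᵥ 1 ≤ (M ^ j) *ᵥ 1 := by
    intro j
    induction j with
    | zero => simp
    | succ j ih =>
      exact (le_add_of_nonneg_right (smul_nonneg (by norm_num) (hnn j))).trans (hstep j ih)
  have h1 := dotProduct_le_dotProduct_of_nonneg_left (hstep k (hle k))
    (zero_le_one (α := Fin n → ℝ))
  rw [dotProduct_add, dotProduct_smul, smul_eq_mul] at h1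
  have h2 : 1 ⬝ᵥ (W ^ (k + 1)) *ᵥ 1 ≤ n * (1 ⬝ᵥ (W ^ k) *ᵥ 1) := by
    rw [pow_succ', ← Matrix.mulVec_mulVec]
    have h3 : ∀ u, (W *ᵥ ((W ^ k) *ᵥ 1)) u ≤ 1 ⬝ᵥ (W ^ k) *ᵥ 1 := fun u ↦
      dotProduct_le_dotProduct_of_nonneg_right (hW1 u) (hnn k)
    calc _ = ∑ u, (W *ᵥ ((W ^ k) *ᵥ 1)) u := one_dotProduct _
      _ ≤ ∑ _u : Fin n, 1 ⬝ᵥ (W ^ k) *ᵥ 1 := Finset.sum_le_sum fun u _ ↦ h3 u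
      _ = _ := by simp
  have h4 : 1 / (2 * n) * (1 ⬝ᵥ (W ^ (k + 1)) *ᵥ 1) ≤ 1 / 2 * (1 ⬝ᵥ (W ^ k) *ᵥ 1) := by
    rw [div_mul_eq_mul_div, one_mul, div_le_iff₀ (by positivity)]
    linarith
  linarith

/-- The number of directed paths is at most the number of directed walks. -/
lemma card_paths_le_walks {ι : Type*} [Fintype ι] [DecidableEq ι] (r : ι → ι → Prop)
    [DecidableRel r] (k : ℕ) :
    (Nat.card {v : Fin (k + 1) → ι // Function.Injective v ∧
      ∀ i : Fin k, r (v i.castSucc) (v i.succ)} : ℝ) ≤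
      1 ⬝ᵥ ((Matrix.of fun u v ↦ if r u v then (1 : ℝ) else 0) ^ k) *ᵥ 1 := by
  classical
  rw [← sum_prod_eq_dotProduct_pow_mulVec, Nat.card_eq_fintype_card, Fintype.card_subtype,
    Finset.card_eq_sum_ones, Finset.sum_filter, Nat.cast_sum]
  refine Finset.sum_le_sum fun v _ ↦ ?_
  simp only [Pi.one_apply, one_mul, Matrix.of_apply]
  split_ifs with h
  · simp [h.2]
  · rw [Nat.cast_zero]
    exact Finset.prod_nonneg fun i _ ↦ by split_ifs <;> norm_num

theorem tournament_stability (n k : ℕ) (hk : 2 ≤ k) (ε : ℝ) (hε : 0 ≤ ε)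
    (r : Fin n → Fin n → Prop) [DecidableRel r]
    (hirr : ∀ u, ¬ r u u)
    (htour : ∀ u v : Fin n, u ≠ v → (r u v ↔ ¬ r v u))
    (hdev : ε * n^2 ≤ ∑ v : Fin n,
      |((Finset.univ.filter (fun u => r u v)).card : ℝ) - n / 2|) :
    (Nat.card {v : Fin (k+1) → Fin n // Function.Injective v ∧
      ∀ i : Fin k, r (v i.castSucc) (v i.succ)} : ℝ) ≤
      (1 - 2 * ε^2) * n * (n / 2 : ℝ) ^ k := by
  have hpath := card_paths_le_walks r k
  obtain ⟨k, rfl⟩ := Nat.exists_eq_add_of_le' hk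
  rcases Nat.eq_zero_or_pos n with rfl | hn
  · simp
  have hn0 : (0 : ℝ) < n := by exact_mod_cast hn
  set W : Matrix (Fin n) (Fin n) ℝ := Matrix.of fun u v ↦ if r u v then (1 : ℝ) else 0 with hW
  have hW0 : ∀ u v, 0 ≤ W u v := fun u v ↦ by simp only [hW, Matrix.of_apply]; split_ifs <;> simp
  have hW1 : ∀ u v, W u v ≤ 1 := fun u v ↦ by simp only [hW, Matrix.of_apply]; split_ifs <;> simp
  set M := W + (1 / 2 : ℝ) • (1 : Matrix (Fin n) (Fin n) ℝ) with hM
  have hMM : ∀ u v, M u v + M v u = 1 := fun u v ↦ by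
    rcases eq_or_ne u v with rfl | huv
    · simp [hM, hW, hirr]
      norm_num
    · have h := htour u v huv
      by_cases h' : r v u <;> simp [hM, hW, h, h', huv, huv.symm]
  have hM0 : ∀ u v, 0 ≤ M u v := fun u v ↦ by
    have h := hW0 u v
    simp only [hM, Matrix.add_apply, Matrix.smul_apply, Matrix.one_apply, smul_eq_mul]
    split_ifs <;> linarith
  have hwalk := one_dotProduct_pow_mulVec_le hn.ne' hM0 hMM k
  have hcmp := walk_count_le_add_half hn.ne' hW0 hW1 (k + 1)
  rw [← hM] at hcmp
  set d : Fin n → ℝ := fun v ↦ ((Finset.univ.filter (fun u => r u v)).card : ℝ) with hd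
  have hrow : ∀ u, 2 * ∑ v, M u v - n = -(2 * d u + 1 - n) := by
    intro u
    have h1 : ∑ v, M v u = d u + 1 / 2 := by
      simp only [hM, hW, hd, Matrix.add_apply, Matrix.smul_apply, Matrix.one_apply,
        Matrix.of_apply, Finset.sum_add_distrib]
      simp
    have h2 : ∑ v, M u v + ∑ v, M v u = n := by
      rw [← Finset.sum_add_distrib]
      simp [hMM]
    linarith
  have hsum0 : ∑ u, (2 * d u + 1 - n) = 0 := by
    have h1 : ∑ u, ∑ v, (M u v + M v u) = (n : ℝ) ^ 2 := by simp [hMM, sq]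
    simp only [Finset.sum_add_distrib] at h1
    rw [Finset.sum_comm (f := fun u v ↦ M v u)] at h1
    have h2 : ∑ u, (2 * ∑ v, M u v - n) = -∑ u, (2 * d u + 1 - n) := by
      rw [← Finset.sum_neg_distrib]
      exact Finset.sum_congr rfl fun u _ ↦ hrow u
    rw [Finset.sum_sub_distrib, ← Finset.mul_sum] at h2
    simp only [Finset.sum_const, Finset.card_univ, Fintype.card_fin, nsmul_eq_mul] at h2
    linarith
  have hD : ∑ u, (2 * ∑ v, M u v - n) ^ 2 = ∑ u, (2 * d u + 1 - n) ^ 2 :=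
    Finset.sum_congr rfl fun u _ ↦ by rw [hrow, neg_sq]
  rw [hD] at hwalk
  set D := ∑ u, (2 * d u + 1 - n) ^ 2
  have hdev2 : 4 * ε ^ 2 ≤ D / n ^ 3 + 1 / n ^ 2 := by
    have h1 : (∑ v, |d v - n / 2|) ^ 2 ≤ n * ∑ v, (d v - n / 2) ^ 2 := by
      simpa using sq_sum_le_card_mul_sum_sq (s := Finset.univ) (f := fun v ↦ |d v - n / 2|)
    have h2 : (ε * n ^ 2) ^ 2 ≤ (∑ v, |d v - n / 2|) ^ 2 := by gcongr
    have h3 : 4 * ∑ v, (d v - n / 2) ^ 2 = D + n := by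
      have h : ∑ v, 4 * (d v - n / 2) ^ 2 =
          ∑ v, ((2 * d v + 1 - n) ^ 2 - 2 * (2 * d v + 1 - n) + 1) :=
        Finset.sum_congr rfl fun v _ ↦ by ring
      rw [Finset.mul_sum, h, Finset.sum_add_distrib, Finset.sum_sub_distrib, ← Finset.mul_sum,
        hsum0]
      simp [D]
    have h4 : D / n ^ 3 + 1 / n ^ 2 = n * (D + n) / n ^ 4 := by field_simp
    rw [h4, le_div_iff₀ (by positivity)]
    nlinarith
  rcases eq_or_lt_of_le (Nat.succ_le_of_lt hn) with rfl | hn2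
  · have h : IsEmpty {v : Fin (k + 2 + 1) → Fin 1 // Function.Injective v ∧
        ∀ i : Fin (k + 2), r (v i.castSucc) (v i.succ)} :=
      ⟨fun v ↦ hirr 0 (by convert v.2.2 0)⟩
    have hD0 : D = 0 := by simpa [D] using hsum0
    rw [Nat.card_of_isEmpty]
    norm_num [hD0] at hdev2 ⊢
    linarith
  have hd_le : ∀ u, d u ≤ n - 1 := fun u ↦ by
    have h1 : Finset.univ.filter (fun v => r v u) ⊆ Finset.univ.erase u := fun v hv ↦ by
      rw [Finset.mem_filter] at hv
      exact Finset.mem_erase.2 ⟨fun h ↦ hirr u (h ▸ hv.2), Finset.mem_univ v⟩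
    have h2 := Finset.card_le_card h1
    rw [Finset.card_erase_of_mem (Finset.mem_univ u), Finset.card_univ, Fintype.card_fin] at h2
    rw [← Nat.cast_one, ← Nat.cast_sub hn]
    exact Nat.cast_le.2 h2
  have hD_le : D ≤ n * (n - 1) ^ 2 := by
    calc D ≤ ∑ _u : Fin n, (n - 1 : ℝ) ^ 2 := by
          refine Finset.sum_le_sum fun u _ ↦ sq_le_sq' ?_ (by linarith [hd_le u])
          linarith [(Nat.cast_nonneg _ : 0 ≤ d u)]
      _ = n * (n - 1) ^ 2 := by simp
  have hη : (1 / n : ℝ) ≤ 1 / 2 := by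
    have h : (2 : ℝ) ≤ n := by exact_mod_cast hn2
    gcongr
  have hη0 : (0 : ℝ) < 1 / n := by positivity
  have hm : D / n ^ 3 ≤ (1 - 1 / n) ^ 2 := by
    have h : ((1 : ℝ) - 1 / n) ^ 2 = n * (n - 1) ^ 2 / n ^ 3 := by field_simp
    rw [h]
    gcongr
  have hdev3 : 4 * ε ^ 2 ≤ D / n ^ 3 + (1 / n) ^ 2 := by rwa [one_div_pow]
  have hhalf : (1 : ℝ) / (2 * n) = 1 / n / 2 := by field_simp
  rw [hhalf] at hcmp
  have hfinal := hcmp.trans hwalk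
  refine hpath.trans ?_
  rw [mul_assoc] at hfinal ⊢
  have hA : (0 : ℝ) ≤ n * (n / 2) ^ (k + 2) := by positivity
  generalize (n : ℝ) * (n / 2) ^ (k + 2) = A at hfinal hA ⊢
  generalize D / (n : ℝ) ^ 3 = m at hfinal hm hdev3
  generalize (1 : ℝ) / n = η at hfinal hm hdev3 hη hη0
  have hcoef : 1 - m / 2 ≤ (1 + η / 2) * (1 - 2 * ε ^ 2) := by
    have h1 : (1 + η / 2) * (1 - (m + η ^ 2) / 2) ≤ (1 + η / 2) * (1 - 2 * ε ^ 2) := by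
      gcongr
      linarith
    nlinarith [mul_nonneg hη0.le (sub_nonneg.2 hm), mul_nonneg hη0.le hη0.le,
      mul_nonneg (mul_nonneg hη0.le hη0.le) hη0.le, mul_nonneg hη0.le (sub_nonneg.2 hη),
      mul_nonneg (mul_nonneg hη0.le hη0.le) (sub_nonneg.2 hη)]
  refine le_of_mul_le_mul_left (hfinal.trans ?_) (by positivity : 0 < 1 + η / 2)
  rw [← mul_assoc]
  gcongr
end
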